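/- Let P ⊆ ℕ. If P is not a Δ*-set (i.e. there exists a Δ-set disjoint from P), then the topological entropy h_{σ_P} of the spacing shift (Σ_P, σ_P) is zero. -/

import Mathlib

open Filter Topology

/-- The spacing shift `Σ_P ⊆ {0,1}^ℕ` determined by `P ⊆ ℕ`: a `0`-`1` sequence `x`
(encoded as `x : ℕ → Bool`) belongs to `Σ_P` iff whenever two coordinates are `1`,
the (positive) distance between them lies in `P`. -/
def SpacingShift (P : Set ℕ) : Set (ℕ → Bool) :=
  {x | ∀ i j : ℕ, i < j → x i = true → x j = true → j - i ∈ P}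

/-- The left shift map `σ` on sequences. -/
def shift (x : ℕ → Bool) : ℕ → Bool := fun n => x (n + 1)

/-- The support `A_y = {i : y_i = 1}` of a point of the shift space. -/
def supp (x : ℕ → Bool) : Set ℕ := {i | x i = true}

/-- `A ⊆ ℕ` has density `d`, i.e. `|A ∩ {1,…,n}| / n → d`. -/
def HasDensity (A : Set ℕ) (d : ℝ) : Prop :=
  Tendsto (fun n : ℕ => (Nat.card (A ∩ Set.Icc 1 n : Set ℕ) : ℝ) / n) atTop (𝓝 d)

/-- The upper density `d̄(A) = limsup_n |A ∩ {1,…,n}| / n`. -/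
noncomputable def upperDensity (A : Set ℕ) : ℝ :=
  limsup (fun n : ℕ => (Nat.card (A ∩ Set.Icc 1 n : Set ℕ) : ℝ) / n) atTop

/-- The upper Banach density `d*(A)`: the limsup, as the window length tends to infinity,
of the maximal proportion of elements of `A` in a window of that length. -/
noncomputable def upperBanachDensity (A : Set ℕ) : ℝ :=
  limsup (fun n : ℕ =>
    ⨆ m : ℕ, (Nat.card (A ∩ Set.Icc m (m + n) : Set ℕ) : ℝ) / (n + 1)) atTop

/-- `D ⊆ ℕ` is a Δ-set: it contains the difference set `{s_i - s_j : i > j}` of some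
strictly increasing sequence of natural numbers. -/
def IsDeltaSet (D : Set ℕ) : Prop :=
  ∃ s : ℕ → ℕ, StrictMono s ∧ ∀ i j : ℕ, j < i → s i - s j ∈ D

/-- `D ⊆ ℕ` is a Δ*-set: it meets every Δ-set. -/
def IsDeltaStarSet (D : Set ℕ) : Prop :=
  ∀ D' : Set ℕ, IsDeltaSet D' → (D ∩ D').Nonempty

open Classical in
/-- The standard metric on the shift space: `d(x,y) = 2^{-min{n : x_n ≠ y_n}}`,
and `d(x,x) = 0`. -/
noncomputable def seqDist (x y : ℕ → Bool) : ℝ :=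
  if x = y then 0 else (2 : ℝ)⁻¹ ^ sInf {n : ℕ | x n ≠ y n}

/-- The set `FS((a_n))` of finite sums of a sequence of natural numbers:
all sums `a_{i_1} + ⋯ + a_{i_k}` with `i_1 < ⋯ < i_k`. -/
def FSseq (a : ℕ → ℕ) : Set ℕ :=
  {n | ∃ F : Finset ℕ, F.Nonempty ∧ n = ∑ i ∈ F, a i}

/-- `S ⊆ ℕ` is an IP-set: it contains the finite sums of some sequence of positive
natural numbers. -/
def IsIPSet (S : Set ℕ) : Prop :=
  ∃ a : ℕ → ℕ, (∀ n, 0 < a n) ∧ FSseq a ⊆ S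

/-- The set `FS(A)` of finite sums of distinct elements of a set `A ⊆ ℕ`. -/
def FSset (A : Set ℕ) : Set ℕ :=
  {n | ∃ F : Finset ℕ, ↑F ⊆ A ∧ F.Nonempty ∧ n = ∑ i ∈ F, i}

/-- The spacing shift `(Σ_P, σ_P)` is topologically transitive: some point of `Σ_P`
has forward orbit (under the shift) dense in `Σ_P`. -/
def IsTransitiveShift (P : Set ℕ) : Prop :=
  ∃ x ∈ SpacingShift P, SpacingShift P ⊆ closure {y : ℕ → Bool | ∃ n : ℕ, shift^[n] x = y}

/-- `E ⊆ ℕ` is density intersective: it meets the difference set `A - A` of every set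
`A ⊆ ℕ` of positive upper Banach density. -/
def DensityIntersective (E : Set ℕ) : Prop :=
  ∀ A : Set ℕ, 0 < upperBanachDensity A → ∃ a ∈ A, ∃ a' ∈ A, a' < a ∧ a - a' ∈ E

open Classical in
/-- Pairwise disjointness of the translates `A + s i` of the support `A` of a point of `Σ_P`
bounds the number of ones in an initial window. -/
theorem card_mul_le_of_mem_spacingShift {P : Set ℕ} {s : ℕ → ℕ} (hs : StrictMono s)
    (hP : ∀ i j, j < i → s i - s j ∉ P) {x : ℕ → Bool} (hx : x ∈ SpacingShift P) (k m : ℕ) :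
    k * ((Finset.range m).filter (fun i => x i = true)).card ≤ m + s k := by
  have disj : ∀ i j a b, j < i → x a = true → x b = true → s i + a ≠ s j + b := by
    intro i j a b hij ha hb h
    have hlt := hs hij
    refine hP i j hij ?_
    have h' : s i - s j = b - a := by omega
    rw [h']
    exact hx a b (by omega) ha hb
  rw [← Finset.card_range k, ← Finset.card_product, Finset.card_range k,
    ← Finset.card_range (m + s k)]
  refine Finset.card_le_card_of_injOn (fun p => s p.1 + p.2) ?_ ?_
  · rintro ⟨i, a⟩ h
    simp only [Finset.coe_product, Set.mem_prod, Finset.mem_coe, Finset.mem_range,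
      Finset.mem_filter] at h ⊢
    have := hs h.1
    omega
  · rintro ⟨i, a⟩ h ⟨j, b⟩ h' e
    simp only [Finset.coe_product, Set.mem_prod, Finset.mem_coe, Finset.mem_range,
      Finset.mem_filter] at h h' e
    rcases lt_trichotomy i j with hij | rfl | hij
    · exact absurd e.symm (disj j i b a hij h'.2.2 h.2.2)
    · simpa using e
    · exact absurd e (disj i j a b hij h.2.2 h'.2.2)

/-- A family of small subsets of `{0, …, m - 1}` has few members. -/
theorem card_filter_powerset_le {r : ℝ} (hr : 0 ≤ r) {k : ℕ} (hk : 1 ≤ (1 + r) ^ k * r)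
    (m C : ℕ) :
    (((Finset.range m).powerset.filter (fun S => k * S.card ≤ m + C)).card : ℝ) ≤
      (1 + r) ^ (2 * m + C) := by
  have key : ∀ S ∈ (Finset.range m).powerset.filter (fun S => k * S.card ≤ m + C),
      (1 : ℝ) ≤ (1 + r) ^ (m + C) * r ^ S.card := by
    intro S hS
    calc (1 : ℝ) ≤ ((1 + r) ^ k * r) ^ S.card := one_le_pow₀ hk
      _ = (1 + r) ^ (k * S.card) * r ^ S.card := by rw [mul_pow, pow_mul]
      _ ≤ _ := by
        gcongr
        · linarith
        · exact (Finset.mem_filter.1 hS).2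
  calc (((Finset.range m).powerset.filter (fun S => k * S.card ≤ m + C)).card : ℝ)
      ≤ ∑ S ∈ (Finset.range m).powerset.filter (fun S => k * S.card ≤ m + C),
          (1 + r) ^ (m + C) * r ^ S.card := by
        simpa using Finset.sum_le_sum key
    _ ≤ ∑ S ∈ (Finset.range m).powerset, (1 + r) ^ (m + C) * r ^ S.card :=
        Finset.sum_le_sum_of_subset_of_nonneg (Finset.filter_subset _ _)
          fun _ _ _ => by positivity
    _ = (1 + r) ^ (2 * m + C) := by
        have := Finset.prod_one_add (f := fun _ => r) (Finset.range m)
        simp only [Finset.prod_const, Finset.card_range] at this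
        rw [← Finset.mul_sum, ← this, ← pow_add]
        congr 1
        ring

theorem shift_iterate_apply (x : ℕ → Bool) (k i : ℕ) : shift^[k] x i = x (i + k) := by
  induction k generalizing x with
  | zero => rfl
  | succ k ih => rw [Function.iterate_succ_apply, ih, shift, add_assoc]

theorem exists_forall_lt_eq_imp_mem_of_mem_uniformity {U : SetRel (ℕ → Bool) (ℕ → Bool)}
    (hU : U ∈ uniformity (ℕ → Bool)) :
    ∃ N : ℕ, ∀ x y : ℕ → Bool, (∀ i < N, x i = y i) → (x, y) ∈ U := by
  simp only [Pi.uniformity, DiscreteUniformity.eq_principal_setRelId, comap_principal] at hU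
  obtain ⟨t, ht, hsub⟩ := (hasBasis_iInf_principal_finite _).mem_iff.1 hU
  obtain ⟨N, hN⟩ := ht.bddAbove
  refine ⟨N + 1, fun x y hxy => hsub ?_⟩
  simp only [Set.mem_iInter, Set.mem_preimage]
  exact fun i hi => hxy i (Nat.lt_succ_of_le (hN hi))

open Classical in
theorem isDynCoverOf_image_indicator {F : Set (ℕ → Bool)} {U : SetRel (ℕ → Bool) (ℕ → Bool)}
    {N n : ℕ} (hU : ∀ x y : ℕ → Bool, (∀ i < N, x i = y i) → (x, y) ∈ U)
    {A : Finset (Finset ℕ)}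
    (hA : ∀ x ∈ F, (Finset.range (n + N)).filter (fun i => x i = true) ∈ A) :
    Dynamics.IsDynCoverOf shift F U n
      (A.image (fun S i => decide (i ∈ S)) : Finset (ℕ → Bool)) := by
  intro x hx
  refine ⟨_, Finset.mem_coe.2 (Finset.mem_image_of_mem _ (hA x hx)), ?_⟩
  rw [Dynamics.mem_dynEntourage]
  intro k hk
  refine hU _ _ fun i hi => ?_
  have : i + k < n + N := by omega
  simp [shift_iterate_apply, this]

theorem coverEntropyEntourage_spacingShift_le {P : Set ℕ} {s : ℕ → ℕ} (hs : StrictMono s)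
    (hP : ∀ i j, j < i → s i - s j ∉ P) {U : SetRel (ℕ → Bool) (ℕ → Bool)}
    (hU : U ∈ uniformity (ℕ → Bool)) {c : ℝ} (hc : 0 < c) :
    Dynamics.coverEntropyEntourage shift (SpacingShift P) U ≤ ((3 * c : ℝ) : EReal) := by
  classical
  obtain ⟨N, hN⟩ := exists_forall_lt_eq_imp_mem_of_mem_uniformity hU
  obtain ⟨r, hr⟩ : ∃ r, r = Real.exp c - 1 := ⟨_, rfl⟩
  have hr0 : 0 < r := by rw [hr, sub_pos]; exact Real.one_lt_exp_iff.2 hc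
  have hr1 : 1 + r = Real.exp c := by rw [hr]; ring
  obtain ⟨k, hk⟩ := pow_unbounded_of_one_lt r⁻¹ (by linarith : 1 < 1 + r)
  have hk' : 1 ≤ (1 + r) ^ k * r := (inv_le_iff_one_le_mul₀ hr0).1 hk.le
  apply Eventually.expGrowthSup_le
  filter_upwards [eventually_ge_atTop (2 * N + s k)] with n hn
  let A := (Finset.range (n + N)).powerset.filter (fun S => k * S.card ≤ (n + N) + s k)
  have hcover := isDynCoverOf_image_indicator (n := n) (A := A) (F := SpacingShift P) hN
    (fun x hx => Finset.mem_filter.2 ⟨Finset.mem_powerset.2 (Finset.filter_subset _ _),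
      card_mul_le_of_mem_spacingShift hs hP hx k (n + N)⟩)
  have hcard : ((A.image (fun S i => decide (i ∈ S))).card : ℝ) ≤
      (1 + r) ^ (2 * (n + N) + s k) :=
    (Nat.cast_le.2 Finset.card_image_le).trans
      (card_filter_powerset_le hr0.le hk' (n + N) (s k))
  have hbound := hcard.trans (pow_le_pow_right₀ (by linarith : 1 ≤ 1 + r)
    (by omega : 2 * (n + N) + s k ≤ 3 * n))
  rw [hr1, ← Real.exp_nat_mul] at hbound
  refine (ENat.toENNReal_mono hcover.coverMincard_le_card).trans ?_
  have hexp : ((3 * c : ℝ) : EReal) * (n : EReal) = ((((3 * n : ℕ) : ℝ) * c : ℝ) : EReal) := by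
    rw [← EReal.coe_natCast, ← EReal.coe_mul]
    congr 1
    push_cast
    ring
  rw [hexp, EReal.exp_coe, ENat.toENNReal_coe, ← ENNReal.ofReal_natCast]
  exact ENNReal.ofReal_le_ofReal hbound

/-- If `P` is not a Δ*-set, then `h_{σ_P} = 0`. -/
theorem not_deltaStar_implies_entropy_zero (P : Set ℕ)
    (h : ¬ IsDeltaStarSet P) :
    Dynamics.coverEntropy shift (SpacingShift P) = 0 := by
  obtain ⟨D, ⟨s, hs, hD⟩, hPD⟩ : ∃ D, IsDeltaSet D ∧ ¬ (P ∩ D).Nonempty := by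
    simpa only [IsDeltaStarSet, not_forall, exists_prop] using h
  have hP : ∀ i j, j < i → s i - s j ∉ P := fun i j hij hmem => hPD ⟨_, hmem, hD i j hij⟩
  refine le_antisymm (iSup₂_le fun U hU => ?_)
    (Dynamics.coverEntropy_nonneg _ ⟨fun _ => false, fun i j _ hi => by simp at hi⟩)
  refine EReal.le_of_forall_lt_iff_le.1 fun z hz => ?_
  have hz' : 0 < z := EReal.coe_pos.1 hz
  simpa [mul_div_cancel₀] using
    coverEntropyEntourage_spacingShift_le hs hP hU (c := z / 3) (by positivity)
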